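/- Let D ≥ 3. A bilinear map α : m × m → m is rotation equivariant and galilean-boost equivariant if and only if there exist real numbers ν, ξ such that α((h,p),(h',p')) = ((ν+ξ) h h', ν h p' + ξ h' p) for all (h,p),(h',p') ∈ m; that is, the invariant Nomizu maps of the (D+1)-dimensional galilean homogeneous spacetimes form exactly the two-parameter family with α(H,H) = (ν+ξ)H, α(H,P_a) = ν P_a, α(P_a,H) = ξ P_a and α(P_a,P_b) = 0. -/

import Mathlib

open Matrix

/-- The vector space `m = ℝ × ℝ^D`, with elements written `(h, p)`;
`H = (1, 0)` and `P a = (0, e a)`. -/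
abbrev Mspace (D : ℕ) : Type := ℝ × (Fin D → ℝ)

/-- The infinitesimal rotation `ρ_Λ (h, p) = (0, Λ p)` associated to a `D × D` matrix `Λ`. -/
noncomputable def rotMap {D : ℕ} (Λ : Matrix (Fin D) (Fin D) ℝ) :
    Mspace D →ₗ[ℝ] Mspace D :=
  LinearMap.prod 0 (Λ.mulVecLin ∘ₗ LinearMap.snd ℝ ℝ (Fin D → ℝ))

/-- The galilean boost `β_a (h, p) = (0, h • e_a)`. -/
noncomputable def galBoost {D : ℕ} (a : Fin D) : Mspace D →ₗ[ℝ] Mspace D :=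
  LinearMap.prod 0
    (LinearMap.toSpanSingleton ℝ (Fin D → ℝ) (Pi.single a 1) ∘ₗ
      LinearMap.fst ℝ ℝ (Fin D → ℝ))

/-- A bilinear map `α : m × m → m` is equivariant under a linear endomorphism `X` of `m`
if `X (α Y Z) = α (X Y) Z + α Y (X Z)` for all `Y Z ∈ m`. -/
def IsEquivariant {D : ℕ} (X : Mspace D →ₗ[ℝ] Mspace D)
    (α : Mspace D →ₗ[ℝ] Mspace D →ₗ[ℝ] Mspace D) : Prop :=
  ∀ Y Z : Mspace D, X (α Y Z) = α (X Y) Z + α Y (X Z)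

theorem transpose_single_sub_single {n : Type*} [DecidableEq n] (a b : n) :
    (Matrix.single a b (1 : ℝ) - Matrix.single b a 1)ᵀ
      = -(Matrix.single a b 1 - Matrix.single b a 1) := by
  simp [Matrix.transpose_sub]

theorem single_sub_single_mulVec {n : Type*} [Fintype n] [DecidableEq n] (a b : n) (v : n → ℝ) :
    (Matrix.single a b (1 : ℝ) - Matrix.single b a 1) *ᵥ v
      = Pi.single a (v b) - Pi.single b (v a) := by
  ext i
  simp [Matrix.sub_mulVec, Matrix.single_mulVec, Pi.single_apply, Function.update_apply]

/-- A vector annihilated by all skew-symmetric matrices is zero in dimension at least two. -/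
theorem eq_zero_of_skew_mulVec_eq_zero {n : Type*} [Fintype n] [DecidableEq n] [Nontrivial n]
    (w : n → ℝ) (hw : ∀ Λ : Matrix n n ℝ, Λᵀ = -Λ → Λ *ᵥ w = 0) : w = 0 := by
  ext b
  obtain ⟨a, hab⟩ := exists_ne b
  have h := congrFun (hw _ (transpose_single_sub_single a b)) a
  simpa [single_sub_single_mulVec, hab] using h

/-- A linear map commuting with all skew-symmetric matrices is a scalar in dimension at least
three. -/
theorem exists_eq_smul_of_commute_skew {n : Type*} [Fintype n] [DecidableEq n]
    (hn : 3 ≤ Fintype.card n) (T : (n → ℝ) →ₗ[ℝ] (n → ℝ))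
    (hT : ∀ Λ : Matrix n n ℝ, Λᵀ = -Λ → ∀ v, Λ *ᵥ T v = T (Λ *ᵥ v)) :
    ∃ ν : ℝ, ∀ v, T v = ν • v := by
  have hcomm (a b : n) (v : n → ℝ) :
      Pi.single a (T v b) - Pi.single b (T v a) = T (Pi.single a (v b) - Pi.single b (v a)) := by
    simpa only [single_sub_single_mulVec] using hT _ (transpose_single_sub_single a b) v
  have hoff (b c : n) (hbc : b ≠ c) : T (Pi.single c 1) b = 0 := by
    obtain ⟨a, ha⟩ : ∃ a, a ∉ ({b, c} : Finset n) := by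
      by_contra! h
      have h₁ : Fintype.card n ≤ ({b, c} : Finset n).card := by
        rw [← Finset.card_univ]
        exact Finset.card_le_card fun x _ => h x
      have h₂ : ({b, c} : Finset n).card ≤ 2 := Finset.card_le_two
      omega
    simp only [Finset.mem_insert, Finset.mem_singleton, not_or] at ha
    have h := congrFun (hcomm a b (Pi.single c 1)) a
    simpa [ha.1, ha.2, hbc] using h
  have hdiag (a b : n) : T (Pi.single a 1) a = T (Pi.single b 1) b := by
    rcases eq_or_ne a b with rfl | hab
    · rfl
    · have h := congrFun (hcomm a b (Pi.single b 1)) a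
      simpa [hab] using h.symm
  have : Nonempty n := Fintype.card_pos_iff.mp (by omega)
  obtain ⟨a₀⟩ := this
  refine ⟨T (Pi.single a₀ 1) a₀, fun v => ?_⟩
  suffices h : T = T (Pi.single a₀ 1) a₀ • LinearMap.id by
    simpa using LinearMap.congr_fun h v
  ext b c
  rcases eq_or_ne c b with rfl | hcb
  · simpa using hdiag c a₀
  · simpa [hcb] using hoff c b hcb

@[simp]
theorem rotMap_apply {D : ℕ} (Λ : Matrix (Fin D) (Fin D) ℝ) (v : Mspace D) :
    rotMap Λ v = (0, Λ *ᵥ v.2) := rfl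

@[simp]
theorem galBoost_apply {D : ℕ} (a : Fin D) (v : Mspace D) :
    galBoost a v = (0, v.1 • Pi.single a 1) := rfl

/-- For `D ≥ 3`, a bilinear map `α` on `m = ℝ × ℝ^D` is rotation equivariant and
galilean-boost equivariant if and only if there are `ν ξ : ℝ` with
`α((h,p),(h',p')) = ((ν+ξ) h h', ν h p' + ξ h' p)`; i.e. the invariant Nomizu maps of
the `(D+1)`-dimensional galilean homogeneous spacetimes form exactly the two-parameter
family `α(H,H) = (ν+ξ)H`, `α(H,P_a) = ν P_a`, `α(P_a,H) = ξ P_a`, `α(P_a,P_b) = 0`. -/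
theorem galilean_nomizu_maps (D : ℕ) (hD : 3 ≤ D)
    (α : Mspace D →ₗ[ℝ] Mspace D →ₗ[ℝ] Mspace D) :
    ((∀ Λ : Matrix (Fin D) (Fin D) ℝ, Λᵀ = -Λ → IsEquivariant (rotMap Λ) α) ∧
      (∀ a : Fin D, IsEquivariant (galBoost a) α))
    ↔ ∃ ν ξ : ℝ, ∀ v w : Mspace D,
        α v w = (((ν + ξ) * (v.1 * w.1), (ν * v.1) • w.2 + (ξ * w.1) • v.2) : Mspace D) := by
  have mk_zero : ((0, 0) : Mspace D) = 0 := rfl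
  constructor
  · rintro ⟨hrot, hboost⟩
    have : Nontrivial (Fin D) := Fin.nontrivial_iff_two_le.mpr (by omega)
    have boost_HP (a b : Fin D) :
        α (0, Pi.single a 1) (0, Pi.single b 1)
          = (0, (α (1, 0) (0, Pi.single b 1)).1 • Pi.single a 1) := by
      simpa [mk_zero] using (hboost a (1, 0) (0, Pi.single b 1)).symm
    have boost_PH (a b : Fin D) :
        α (0, Pi.single a 1) (0, Pi.single b 1)
          = (0, (α (0, Pi.single a 1) (1, 0)).1 • Pi.single b 1) := by
      simpa [mk_zero] using (hboost b (0, Pi.single a 1) (1, 0)).symm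
    have boost_HH (a : Fin D) :
        α (0, Pi.single a 1) (1, 0) + α (1, 0) (0, Pi.single a 1)
          = (0, (α (1, 0) (1, 0)).1 • Pi.single a 1) := by
      simpa using (hboost a (1, 0) (1, 0)).symm
    have HP_fst (b : Fin D) : (α (1, 0) (0, Pi.single b 1)).1 = 0 := by
      obtain ⟨a, hab⟩ := exists_ne b
      have h := congrFun (congrArg Prod.snd ((boost_HP a b).symm.trans (boost_PH a b))) a
      simpa [hab] using h
    have PP (a b : Fin D) : α (0, Pi.single a 1) (0, Pi.single b 1) = 0 := by
      rw [boost_HP, HP_fst, zero_smul]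
      rfl
    have HH_snd : (α (1, 0) (1, 0)).2 = 0 := by
      refine eq_zero_of_skew_mulVec_eq_zero _ fun Λ hΛ => ?_
      have h := hrot Λ hΛ (1, 0) (1, 0)
      simpa [mk_zero] using congrArg Prod.snd h
    obtain ⟨ν, hν⟩ := exists_eq_smul_of_commute_skew (by simpa using hD)
      (LinearMap.snd ℝ ℝ (Fin D → ℝ) ∘ₗ α (1, 0) ∘ₗ LinearMap.inr ℝ ℝ (Fin D → ℝ))
      fun Λ hΛ v => by simpa [mk_zero] using congrArg Prod.snd (hrot Λ hΛ (1, 0) (0, v))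
    have HP (a : Fin D) : α (1, 0) (0, Pi.single a 1) = (0, ν • Pi.single a 1) :=
      Prod.ext (HP_fst a) (hν (Pi.single a 1))
    obtain ⟨c, hc⟩ : ∃ c, α (1, 0) (1, 0) = (c, 0) := ⟨_, Prod.ext rfl HH_snd⟩
    have PH (a : Fin D) : α (0, Pi.single a 1) (1, 0) = (0, (c - ν) • Pi.single a 1) := by
      rw [eq_sub_of_add_eq (boost_HH a), HP, hc]
      simp [sub_smul]
    let β : Mspace D →ₗ[ℝ] Mspace D →ₗ[ℝ] Mspace D := LinearMap.mk₂ ℝ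
      (fun v w => (c * (v.1 * w.1), (ν * v.1) • w.2 + ((c - ν) * w.1) • v.2))
      (by intros; ext <;> simp <;> ring) (by intros; ext <;> simp <;> ring)
      (by intros; ext <;> simp <;> ring) (by intros; ext <;> simp <;> ring)
    have hαβ : α = β := by
      refine LinearMap.prod_ext (LinearMap.ext_ring ?_)
        (LinearMap.pi_ext' fun a => LinearMap.ext_ring ?_) <;>
      refine LinearMap.prod_ext (LinearMap.ext_ring ?_)
        (LinearMap.pi_ext' fun b => LinearMap.ext_ring ?_)
      · simp [β, hc]
      · simp [β, HP]
      · simp [β, PH]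
      · simp [β, PP, mk_zero]
    refine ⟨ν, c - ν, fun v w => ?_⟩
    rw [hαβ, add_sub_cancel]
    rfl
  · rintro ⟨ν, ξ, h⟩
    refine ⟨fun Λ _ Y Z => ?_, fun a Y Z => ?_⟩
    · simp [h, Matrix.mulVec_add, Matrix.mulVec_smul, add_comm]
    · ext <;> simp [h]
      ring
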